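/- Let n ≥ 2 be an integer and let m satisfy 1 < m < 1 + √(1/(n−1)). Let u be a smooth positive ancient solution of the porous medium equation u_t = Δ(uᵐ) on ℝⁿ × (−∞, t₀], and let v = (m/(m−1))·u^{m−1} be its pressure. Fix x₀ ∈ ℝⁿ. If sup over B(x₀,R) × [t₀ − R², t₀] of v is o( R^{2(m−1)/(2m−1)} ) as R → ∞, then u is constant. -/

import Mathlib

open Metric Set Filter

/-- The Laplacian (in the spatial variable) of a function on `ℝⁿ`, computed as the sum
of the second partial derivatives along the standard coordinate directions. -/
noncomputable def lap {n : ℕ} (f : EuclideanSpace ℝ (Fin n) → ℝ)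
    (x : EuclideanSpace ℝ (Fin n)) : ℝ :=
  ∑ i : Fin n,
    fderiv ℝ (fun y => fderiv ℝ f y (EuclideanSpace.single i 1)) x
      (EuclideanSpace.single i 1)

open scoped ContDiff Topology

section DirectionalDerivative

variable {V : Type*} [NormedAddCommGroup V] [NormedSpace ℝ V]

/-- The derivative of `f` at `p` in the direction `e`. -/
noncomputable def dirDeriv (e : V) (f : V → ℝ) (p : V) : ℝ := fderiv ℝ f p e

theorem ContDiffAt.dirDeriv {f : V → ℝ} {p : V} (hf : ContDiffAt ℝ ∞ f p) (e : V) :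
    ContDiffAt ℝ ∞ (dirDeriv e f) p :=
  (hf.fderiv_right (m := ∞) (by simp)).clm_apply contDiffAt_const

theorem ContDiffAt.differentiableAt_of_smooth {f : V → ℝ} {p : V} (hf : ContDiffAt ℝ ∞ f p) :
    DifferentiableAt ℝ f p :=
  hf.differentiableAt (by simp)

theorem dirDeriv_comm {f : V → ℝ} {p : V} (hf : ContDiffAt ℝ ∞ f p) (d e : V) :
    dirDeriv d (dirDeriv e f) p = dirDeriv e (dirDeriv d f) p := by
  have key : ∀ d e : V, dirDeriv d (dirDeriv e f) p = fderiv ℝ (fderiv ℝ f) p d e := by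
    intro d e
    have h : DifferentiableAt ℝ (fderiv ℝ f) p :=
      (hf.fderiv_right (m := ∞) (by simp)).differentiableAt (by simp)
    change fderiv ℝ (fun y => fderiv ℝ f y e) p d = _
    rw [fderiv_clm_apply h (differentiableAt_const e)]
    simp
  rw [key, key]
  refine (hf.isSymmSndFDerivAt ?_) d e
  rw [minSmoothness_of_isRCLikeNormedField]
  exact WithTop.coe_le_coe.2 le_top

theorem dirDeriv_congr {f g : V → ℝ} {p : V} {s : Set V} (hs : IsOpen s) (hp : p ∈ s)
    (h : ∀ q ∈ s, f q = g q) (e : V) : dirDeriv e f p = dirDeriv e g p := by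
  have : f =ᶠ[𝓝 p] g := by filter_upwards [hs.mem_nhds hp] with q hq using h q hq
  rw [dirDeriv, dirDeriv, this.fderiv_eq]

theorem dirDeriv_fun_add {f g : V → ℝ} {p : V} (hf : DifferentiableAt ℝ f p)
    (hg : DifferentiableAt ℝ g p) (e : V) :
    dirDeriv e (fun q => f q + g q) p = dirDeriv e f p + dirDeriv e g p := by
  simp [dirDeriv, fderiv_fun_add hf hg]

theorem dirDeriv_fun_mul {f g : V → ℝ} {p : V} (hf : DifferentiableAt ℝ f p)
    (hg : DifferentiableAt ℝ g p) (e : V) :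
    dirDeriv e (fun q => f q * g q) p = dirDeriv e f p * g p + f p * dirDeriv e g p := by
  simp [dirDeriv, fderiv_fun_mul hf hg]
  ring

theorem dirDeriv_fun_sum {ι : Type*} [Fintype ι] {f : ι → V → ℝ} {p : V}
    (hf : ∀ i, DifferentiableAt ℝ (f i) p) (e : V) :
    dirDeriv e (fun q => ∑ i, f i q) p = ∑ i, dirDeriv e (f i) p := by
  simp [dirDeriv, fderiv_fun_sum (fun i _ => hf i)]

theorem dirDeriv_const_mul {f : V → ℝ} {p : V} (hf : DifferentiableAt ℝ f p) (c : ℝ) (e : V) :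
    dirDeriv e (fun q => c * f q) p = c * dirDeriv e f p := by
  simp [dirDeriv, fderiv_const_mul hf]

theorem dirDeriv_fun_rpow {f : V → ℝ} {p : V} (hf : DifferentiableAt ℝ f p) (h0 : 0 < f p)
    (r : ℝ) (e : V) :
    dirDeriv e (fun q => f q ^ r) p = r * f p ^ (r - 1) * dirDeriv e f p := by
  simp [dirDeriv, (hf.hasFDerivAt.rpow_const (p := r) (Or.inl h0.ne')).fderiv]

theorem dirDeriv_fun_inv {f : V → ℝ} {p : V} (hf : DifferentiableAt ℝ f p) (h0 : f p ≠ 0)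
    (e : V) : dirDeriv e (fun q => (f q)⁻¹) p = -dirDeriv e f p / f p ^ 2 := by
  have := (hasDerivAt_inv h0).comp_hasFDerivAt p hf.hasFDerivAt
  change fderiv ℝ ((fun y => y⁻¹) ∘ f) p e = _
  rw [this.fderiv]
  simp [dirDeriv]
  ring

theorem dirDeriv_fun_sq {f : V → ℝ} {p : V} (hf : DifferentiableAt ℝ f p) (e : V) :
    dirDeriv e (fun q => f q ^ 2) p = 2 * (f p * dirDeriv e f p) := by
  simp only [pow_two]
  rw [dirDeriv_fun_mul hf hf]
  ring

end DirectionalDerivative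

/-- The Cauchy-Schwarz inequality for a matrix `H` paired with `|g|² I - g ⊗ g`, a matrix of
squared norm `(n - 1) |g|⁴`. -/
theorem sq_trace_sub_quadForm_le {ι : Type*} [Fintype ι] (g : ι → ℝ) (H : ι → ι → ℝ) :
    ((∑ i, g i ^ 2) * ∑ i, H i i - ∑ i, ∑ j, g i * g j * H i j) ^ 2 ≤
      (Fintype.card ι - 1) * (∑ i, g i ^ 2) ^ 2 * ∑ i, ∑ j, H i j ^ 2 := by
  classical
  set G := ∑ i, g i ^ 2 with hG
  have h := Finset.sum_mul_sq_le_sq_mul_sq (Finset.univ : Finset (ι × ι))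
    (fun x => (if x.1 = x.2 then G else 0) - g x.1 * g x.2) (fun x => H x.1 x.2)
  simp only [Fintype.sum_prod_type] at h
  have h1 : ∑ i, ∑ j, ((if i = j then G else 0) - g i * g j) * H i j
      = G * ∑ i, H i i - ∑ i, ∑ j, g i * g j * H i j := by
    simp [sub_mul, Finset.sum_sub_distrib, Finset.mul_sum]
  have h2 : ∑ i, ∑ j, ((if i = j then G else 0) - g i * g j) ^ 2
      = (Fintype.card ι - 1) * G ^ 2 := by
    have e1 : ∀ i j, ((if i = j then G else 0) - g i * g j) ^ 2
        = (if i = j then G ^ 2 else 0) - 2 * (if i = j then G * (g i * g j) else 0)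
          + g i ^ 2 * g j ^ 2 := by
      intro i j
      split_ifs <;> ring
    simp only [e1, Finset.sum_add_distrib, Finset.sum_sub_distrib, ← Finset.mul_sum,
      Finset.sum_ite_eq, Finset.mem_univ, if_true, ← Finset.sum_mul, Finset.sum_const,
      Finset.card_univ, nsmul_eq_mul, ← pow_two, ← hG]
    ring
  rwa [h1, h2] at h

theorem bernstein_algebra {N A w β F Q K Δ X : ℝ} (hN : 0 < N) (hA : 0 < A) (hw : 0 < w)
    (hF : 0 < F) (hX : X = F * Δ - Q / 2) (hK : X ^ 2 ≤ N * F ^ 2 * K) :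
    2 * (1 - β) * A * F * (Δ + β * F / w) / w - 2 * A * K + 2 * A * β * (Q / w - F ^ 2 / w ^ 2) ≤
      A * (-(2 * β ^ 2 - N * (1 - β) ^ 2 / 2) * F ^ 2 / w ^ 2 + (1 + β) * Q / w) := by
  have hK' : X ^ 2 / (N * F ^ 2) ≤ K := by
    rw [div_le_iff₀ (by positivity)]; linarith
  have hsq : 0 ≤ 2 * (X / F - N * (1 - β) * F / (2 * w)) ^ 2 / N := by positivity
  have hΔ : Δ = (X + Q / 2) / F := by rw [hX]; field_simp; ring
  have hid : (-(2 * β ^ 2 - N * (1 - β) ^ 2 / 2) * F ^ 2 / w ^ 2 + (1 + β) * Q / w)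
      - (2 * (1 - β) * F * (Δ + β * F / w) / w - 2 * (X ^ 2 / (N * F ^ 2))
          + 2 * β * (Q / w - F ^ 2 / w ^ 2))
      = 2 * (X / F - N * (1 - β) * F / (2 * w)) ^ 2 / N := by
    rw [hΔ]; field_simp; ring
  have h1 : (2 * (1 - β) * F * (Δ + β * F / w) / w - 2 * K
          + 2 * β * (Q / w - F ^ 2 / w ^ 2)) ≤
      (-(2 * β ^ 2 - N * (1 - β) ^ 2 / 2) * F ^ 2 / w ^ 2 + (1 + β) * Q / w) := by linarith
  calc _ = A * (2 * (1 - β) * F * (Δ + β * F / w) / w - 2 * K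
          + 2 * β * (Q / w - F ^ 2 / w ^ 2)) := by ring
    _ ≤ _ := mul_le_mul_of_nonneg_left h1 hA.le

/-- The differential inequality for `F = |∇w|²` behind the Bernstein method: here `w` solves
`∂_τ w = A (Δw + β |∇w|² / w)`, and `A` is a constant multiple of `w ^ (1 - β)`. -/
theorem bernstein_inequality {V ι : Type*} [NormedAddCommGroup V] [NormedSpace ℝ V] [Fintype ι]
    (hι : 2 ≤ Fintype.card ι) {Ω : Set V} (hΩ : IsOpen Ω) {e : ι → V} {τ : V}
    {w A F : V → ℝ} {β : ℝ}
    (hw : ∀ p ∈ Ω, ContDiffAt ℝ ∞ w p) (hA : ∀ p ∈ Ω, ContDiffAt ℝ ∞ A p)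
    (hw0 : ∀ p ∈ Ω, 0 < w p) (hA0 : ∀ p ∈ Ω, 0 < A p)
    (hF : F = fun p => ∑ i, dirDeriv (e i) w p ^ 2)
    (hAw : ∀ p ∈ Ω, ∀ i, dirDeriv (e i) A p = (1 - β) * A p * dirDeriv (e i) w p / w p)
    (heq : ∀ p ∈ Ω, dirDeriv τ w p =
      A p * (∑ i, dirDeriv (e i) (dirDeriv (e i) w) p + β * (F p * (w p)⁻¹)))
    {p : V} (hp : p ∈ Ω) (hFp : F p ≠ 0) :
    dirDeriv τ F p - A p * ∑ i, dirDeriv (e i) (dirDeriv (e i) F) p ≤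
      A p * (-(2 * β ^ 2 - (Fintype.card ι - 1) * (1 - β) ^ 2 / 2) * F p ^ 2 / w p ^ 2
        + (1 + β) * (∑ i, dirDeriv (e i) w p * dirDeriv (e i) F p) / w p) := by
  have dw : ∀ q ∈ Ω, ∀ v, DifferentiableAt ℝ (dirDeriv v w) q := fun q hq v =>
    ((hw q hq).dirDeriv v).differentiableAt_of_smooth
  have ddw : ∀ q ∈ Ω, ∀ u v, DifferentiableAt ℝ (dirDeriv u (dirDeriv v w)) q := fun q hq u v =>
    (((hw q hq).dirDeriv v).dirDeriv u).differentiableAt_of_smooth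
  have hFs : ∀ q ∈ Ω, ContDiffAt ℝ ∞ F q := by
    intro q hq
    rw [hF]
    exact ContDiffAt.sum fun i _ => ((hw q hq).dirDeriv _).pow 2
  have hF1 : ∀ q ∈ Ω, ∀ v, dirDeriv v F q =
      2 * ∑ i, dirDeriv (e i) w q * dirDeriv v (dirDeriv (e i) w) q := by
    intro q hq v
    rw [hF, dirDeriv_fun_sum (fun i => (dw q hq _).fun_pow 2), Finset.mul_sum]
    exact Finset.sum_congr rfl fun i _ => dirDeriv_fun_sq (dw q hq _) v
  have hF2 : ∀ v, dirDeriv v (dirDeriv v F) p =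
      2 * ∑ i, (dirDeriv v (dirDeriv (e i) w) p ^ 2
        + dirDeriv (e i) w p * dirDeriv v (dirDeriv v (dirDeriv (e i) w)) p) := by
    intro v
    have hd : ∀ i, DifferentiableAt ℝ
        (fun q => dirDeriv (e i) w q * dirDeriv v (dirDeriv (e i) w) q) p :=
      fun i => (dw p hp _).mul (ddw p hp _ _)
    rw [dirDeriv_congr hΩ hp (fun q hq => hF1 q hq v) v,
      dirDeriv_const_mul (DifferentiableAt.fun_sum fun i _ => hd i), dirDeriv_fun_sum hd]
    congr 1
    refine Finset.sum_congr rfl fun i _ => ?_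
    rw [dirDeriv_fun_mul (dw p hp _) (ddw p hp _ _)]
    ring
  have hT : ∀ i, dirDeriv (e i) (fun q => ∑ j, dirDeriv (e j) (dirDeriv (e j) w) q) p
      = ∑ j, dirDeriv (e j) (dirDeriv (e j) (dirDeriv (e i) w)) p := by
    intro i
    rw [dirDeriv_fun_sum (fun j => ddw p hp _ _)]
    refine Finset.sum_congr rfl fun j _ => ?_
    rw [dirDeriv_comm ((hw p hp).dirDeriv _)]
    exact dirDeriv_congr hΩ hp (fun q hq => dirDeriv_comm (hw q hq) _ _) _
  have dF := (hFs p hp).differentiableAt_of_smooth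
  have dw0 := (hw p hp).differentiableAt_of_smooth
  have hne := (hw0 p hp).ne'
  have hτ : ∀ i, dirDeriv τ (dirDeriv (e i) w) p =
      (1 - β) * A p * dirDeriv (e i) w p / w p
        * (∑ j, dirDeriv (e j) (dirDeriv (e j) w) p + β * (F p * (w p)⁻¹))
      + A p * (∑ j, dirDeriv (e j) (dirDeriv (e j) (dirDeriv (e i) w)) p
        + β * (dirDeriv (e i) F p * (w p)⁻¹ + F p * (-dirDeriv (e i) w p / w p ^ 2))) := by
    intro i
    have d1 : DifferentiableAt ℝ (fun q => ∑ j, dirDeriv (e j) (dirDeriv (e j) w) q) p :=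
      DifferentiableAt.fun_sum fun j _ => ddw p hp _ _
    have d2 : DifferentiableAt ℝ (fun q => F q * (w q)⁻¹) p := dF.mul (dw0.fun_inv hne)
    rw [dirDeriv_comm (hw p hp), dirDeriv_congr hΩ hp heq,
      dirDeriv_fun_mul (hA p hp).differentiableAt_of_smooth (d1.fun_add (d2.const_mul β)),
      dirDeriv_fun_add d1 (d2.const_mul β), dirDeriv_const_mul d2,
      dirDeriv_fun_mul dF (dw0.fun_inv hne), dirDeriv_fun_inv dw0 hne, hT, hAw p hp]
  set g : ι → ℝ := fun i => dirDeriv (e i) w p with hg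
  set H : ι → ι → ℝ := fun i j => dirDeriv (e j) (dirDeriv (e i) w) p with hH
  set T : ι → ℝ := fun i => ∑ j, dirDeriv (e j) (dirDeriv (e j) (dirDeriv (e i) w)) p with hTdef
  set D := ∑ j, dirDeriv (e j) (dirDeriv (e j) w) p with hD
  have hFg : F p = ∑ i, g i ^ 2 := by rw [hF]
  have hFpos : 0 < F p :=
    lt_of_le_of_ne (by rw [hFg]; exact Finset.sum_nonneg fun i _ => sq_nonneg _) (Ne.symm hFp)
  set Q := ∑ i, dirDeriv (e i) w p * dirDeriv (e i) F p with hQ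
  have hQH : Q / 2 = ∑ i, ∑ j, g i * g j * H i j := by
    rw [Finset.sum_comm, hQ, Finset.sum_div]
    refine Finset.sum_congr rfl fun j _ => ?_
    rw [hF1 p hp, Finset.mul_sum, Finset.mul_sum, Finset.sum_div]
    refine Finset.sum_congr rfl fun i _ => ?_
    simp only [hg, hH]
    ring
  have hcs := sq_trace_sub_quadForm_le g H
  have hL : ∑ i, dirDeriv (e i) (dirDeriv (e i) F) p
      = 2 * (∑ i, ∑ j, H i j ^ 2) + 2 * ∑ i, g i * T i := by
    have h1 : ∑ i, g i * T i
        = ∑ j, ∑ i, g i * dirDeriv (e j) (dirDeriv (e j) (dirDeriv (e i) w)) p := by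
      rw [Finset.sum_comm]
      exact Finset.sum_congr rfl fun i _ => by rw [hTdef, Finset.mul_sum]
    rw [Finset.sum_comm, h1, ← mul_add, ← Finset.sum_add_distrib, Finset.mul_sum]
    refine Finset.sum_congr rfl fun j _ => ?_
    rw [hF2, Finset.sum_add_distrib]
  have hFτ : dirDeriv τ F p = 2 * (1 - β) * A p * F p * (D + β * F p / w p) / w p
      + 2 * A p * ∑ i, g i * T i + 2 * A p * β * (Q / w p - F p ^ 2 / w p ^ 2) := by
    rw [hF1 p hp]
    have h1 : ∀ i, dirDeriv (e i) w p * dirDeriv τ (dirDeriv (e i) w) p =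
        g i ^ 2 * ((1 - β) * A p * (D + β * F p / w p) / w p - A p * β * F p / w p ^ 2)
        + A p * (g i * T i) + A p * β / w p * (dirDeriv (e i) w p * dirDeriv (e i) F p) := by
      intro i
      rw [hτ]
      simp only [hg, hTdef]
      field_simp
      ring
    simp only [h1, Finset.sum_add_distrib, ← Finset.sum_mul, ← Finset.mul_sum, ← hFg, ← hQ]
    ring
  have hcard : (0 : ℝ) < Fintype.card ι - 1 := by
    have : (2 : ℝ) ≤ Fintype.card ι := by exact_mod_cast hι
    linarith
  rw [← hFg, ← hQH] at hcs
  have := bernstein_algebra (β := β) hcard (hA0 p hp) (hw0 p hp) hFpos rfl hcs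
  rw [hL, hFτ]
  have hDH : ∑ i, H i i = D := rfl
  rw [hDH] at this
  linarith

section MaximumPrinciple

variable {V : Type*} [NormedAddCommGroup V] [NormedSpace ℝ V]

theorem hasDerivAt_line {f : V → ℝ} {p e : V} {r : ℝ} (hf : DifferentiableAt ℝ f (p + r • e)) :
    HasDerivAt (fun r : ℝ => f (p + r • e)) (dirDeriv e f (p + r • e)) r := by
  have h1 : HasDerivAt (fun r : ℝ => p + r • e) e r := by
    simpa using ((hasDerivAt_id r).smul_const e).const_add p
  exact hf.hasFDerivAt.comp_hasDerivAt r h1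

theorem tendsto_line (p e : V) : Tendsto (fun r : ℝ => p + r • e) (𝓝 0) (𝓝 p) := by
  have : Continuous fun r : ℝ => p + r • e := by fun_prop
  simpa using this.tendsto 0

theorem dirDeriv_eq_zero_of_max {f : V → ℝ} {p e : V} (hf : DifferentiableAt ℝ f p)
    (hmax : ∀ᶠ r in 𝓝 (0 : ℝ), f (p + r • e) ≤ f p) : dirDeriv e f p = 0 := by
  have h := hasDerivAt_line (f := f) (p := p) (e := e) (r := 0) (by simpa using hf)
  have hm : IsLocalMax (fun r : ℝ => f (p + r • e)) 0 := by
    simpa [IsLocalMax, IsMaxFilter] using hmax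
  simpa using hm.hasDerivAt_eq_zero h

theorem dirDeriv_dirDeriv_nonpos_of_max {f : V → ℝ} {p e : V} {s : Set V} (hs : IsOpen s)
    (hp : p ∈ s) (hf : ∀ q ∈ s, ContDiffAt ℝ ∞ f q)
    (hmax : ∀ᶠ r in 𝓝 (0 : ℝ), f (p + r • e) ≤ f p) : dirDeriv e (dirDeriv e f) p ≤ 0 := by
  set h : ℝ → ℝ := fun r => f (p + r • e) with hh
  have hd : ∀ᶠ r in 𝓝 (0 : ℝ), HasDerivAt h (dirDeriv e f (p + r • e)) r := by
    filter_upwards [(tendsto_line p e).eventually (hs.mem_nhds hp)] with r hr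
    exact hasDerivAt_line (hf _ hr).differentiableAt_of_smooth
  have hd2 : HasDerivAt (deriv h) (dirDeriv e (dirDeriv e f) p) 0 := by
    have h1 := hasDerivAt_line (f := dirDeriv e f) (p := p) (e := e) (r := 0)
      (by simpa using ((hf p hp).dirDeriv e).differentiableAt_of_smooth)
    simp only [zero_smul, add_zero] at h1
    exact h1.congr_of_eventuallyEq (hd.mono fun r hr => hr.deriv)
  have hm : IsLocalMax h 0 := by simpa [hh, IsLocalMax, IsMaxFilter] using hmax
  by_contra! hpos
  have hmin : IsLocalMin h 0 := isLocalMin_of_deriv_deriv_pos (by rwa [hd2.deriv])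
    hm.deriv_eq_zero hd.self_of_nhds.continuousAt
  have hconst : h =ᶠ[𝓝 0] fun _ => h 0 := by
    filter_upwards [hm, hmin] with r h1 h2 using le_antisymm h1 h2
  have h0 : deriv h =ᶠ[𝓝 0] fun _ => (0 : ℝ) := by
    filter_upwards [hconst.deriv] with r hr
    simp [hr]
  have := hd2.deriv
  rw [h0.deriv_eq, deriv_const] at this
  exact hpos.ne this

theorem dirDeriv_nonneg_of_left_max {f : V → ℝ} {p e : V} (hf : DifferentiableAt ℝ f p)
    (hmax : ∀ᶠ r in 𝓝[<] (0 : ℝ), f (p + r • e) ≤ f p) : 0 ≤ dirDeriv e f p := by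
  have h := hasDerivAt_line (f := f) (p := p) (e := e) (r := 0) (by simpa using hf)
  simp only [zero_smul, add_zero] at h
  have hsl := (hasDerivWithinAt_iff_tendsto_slope' (s := Iio (0 : ℝ)) (by simp)).1
    h.hasDerivWithinAt
  refine ge_of_tendsto hsl ?_
  filter_upwards [hmax, self_mem_nhdsWithin] with r hr hr0
  have hr0 : r < 0 := hr0
  simp only [slope_def_field, zero_smul, add_zero, sub_zero]
  exact div_nonneg_of_nonpos (by linarith) hr0.le

/-- What the differential inequality `bernstein_inequality` gives at an interior maximum of `η F`,
in terms of the values there of the derivatives. -/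
theorem cutoff_mul_le_of_max_algebra {ι : Type*} [Fintype ι] {A w η F κ b ηt Ft : ℝ}
    {g ηi Fi ηii Fii : ι → ℝ} (hA : 0 < A) (hw : 0 < w) (hη : 0 < η) (hF : 0 < F)
    (h1 : ∀ i, ηi i * F + η * Fi i = 0)
    (h2 : ∀ i, ηii i * F + 2 * (ηi i * Fi i) + η * Fii i ≤ 0)
    (ht : 0 ≤ ηt * F + η * Ft)
    (hB : Ft - A * ∑ i, Fii i ≤ A * (-κ * F ^ 2 / w ^ 2 + b * (∑ i, g i * Fi i) / w)) :
    κ * (η * F) ≤ ηt * (w ^ 2 / A) + w ^ 2 * ∑ i, (2 * ηi i ^ 2 / η - ηii i)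
      + b * (-(w * ∑ i, g i * ηi i)) := by
  have hFi : ∀ i, Fi i = -(ηi i * F / η) := by
    intro i; field_simp; linarith [h1 i]
  have hsum : η * ∑ i, Fii i ≤ F * ∑ i, (2 * ηi i ^ 2 / η - ηii i) := by
    rw [Finset.mul_sum, Finset.mul_sum]
    refine Finset.sum_le_sum fun i _ => ?_
    have := h2 i
    rw [hFi] at this
    have e : ηi i * -(ηi i * F / η) = -(F * (ηi i ^ 2 / η)) := by ring
    rw [e] at this
    have e2 : F * (2 * ηi i ^ 2 / η - ηii i) = 2 * (F * (ηi i ^ 2 / η)) - F * ηii i := by ring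
    rw [e2]; linarith
  have hgF : ∑ i, g i * Fi i = -(F / η) * ∑ i, g i * ηi i := by
    rw [Finset.mul_sum]
    exact Finset.sum_congr rfl fun i _ => by rw [hFi]; ring
  set S := ∑ i, (2 * ηi i ^ 2 / η - ηii i)
  set P := ∑ i, g i * ηi i
  rw [hgF] at hB
  have h3 := mul_le_mul_of_nonneg_left hB hη.le
  have h4 := mul_le_mul_of_nonneg_left hsum hA.le
  have h5 : -(ηt * F) - A * (F * S)
      ≤ η * (A * (-κ * F ^ 2 / w ^ 2 + b * (-(F / η) * P) / w)) := by
    nlinarith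
  have e1 : η * (A * (-κ * F ^ 2 / w ^ 2 + b * (-(F / η) * P) / w))
      = (A * F / w ^ 2) * (-κ * (η * F) - b * (w * P)) := by
    field_simp
    ring
  have e2 : -(ηt * F) - A * (F * S)
      = (A * F / w ^ 2) * (-(ηt * (w ^ 2 / A)) - w ^ 2 * S) := by field_simp
  rw [e1, e2] at h5
  have := le_of_mul_le_mul_left h5 (by positivity)
  linarith

theorem dirDeriv_dirDeriv_mul {f g : V → ℝ} {p : V} {s : Set V} (hs : IsOpen s) (hp : p ∈ s)
    (hf : ∀ q ∈ s, ContDiffAt ℝ ∞ f q) (hg : ∀ q ∈ s, ContDiffAt ℝ ∞ g q) (e : V) :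
    dirDeriv e (dirDeriv e (fun q => f q * g q)) p =
      dirDeriv e (dirDeriv e f) p * g p + 2 * (dirDeriv e f p * dirDeriv e g p)
        + f p * dirDeriv e (dirDeriv e g) p := by
  have df := fun q hq => (hf q hq).differentiableAt_of_smooth
  have dg := fun q hq => (hg q hq).differentiableAt_of_smooth
  have ddf := ((hf p hp).dirDeriv e).differentiableAt_of_smooth
  have ddg := ((hg p hp).dirDeriv e).differentiableAt_of_smooth
  rw [dirDeriv_congr hs hp (fun q hq => dirDeriv_fun_mul (df q hq) (dg q hq) e),
    dirDeriv_fun_add (ddf.fun_mul (dg p hp)) ((df p hp).fun_mul ddg),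
    dirDeriv_fun_mul ddf (dg p hp), dirDeriv_fun_mul (df p hp) ddg]
  ring

end MaximumPrinciple

section Cutoff

/-- Space-time `ℝⁿ × ℝ`. -/
abbrev SpaceTime (n : ℕ) : Type := EuclideanSpace ℝ (Fin n) × ℝ

variable {n : ℕ}

/-- The coordinate direction `i` of space, as a direction of space-time. -/
noncomputable def spaceDir (i : Fin n) : SpaceTime n :=
  (EuclideanSpace.single i 1, 0)

/-- The time direction of space-time. -/
noncomputable def timeDir : SpaceTime n := (0, 1)

/-- The time factor of `cutoff`. -/
noncomputable def timeCutoff (c t₀ : ℝ) (p : SpaceTime n) : ℝ :=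
  1 + c * (p.2 - t₀)

/-- The square root of the space factor of `cutoff`. -/
noncomputable def spaceCutoff (c : ℝ) (x₀ : EuclideanSpace ℝ (Fin n))
    (p : SpaceTime n) : ℝ :=
  1 - c * ‖p.1 - x₀‖ ^ 2

/-- A cutoff function that, for `c = R⁻²`, vanishes on the parabolic boundary of
`closedBall x₀ R × [t₀ - R², t₀]`. -/
noncomputable def cutoff (c : ℝ) (x₀ : EuclideanSpace ℝ (Fin n)) (t₀ : ℝ)
    (p : SpaceTime n) : ℝ :=
  timeCutoff c t₀ p * spaceCutoff c x₀ p ^ 2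

variable (c t₀ : ℝ) (x₀ : EuclideanSpace ℝ (Fin n))

theorem contDiff_timeCutoff : ContDiff ℝ ∞ (timeCutoff c t₀ : SpaceTime n → ℝ) := by
  unfold timeCutoff; fun_prop

theorem contDiff_spaceCutoff : ContDiff ℝ ∞ (spaceCutoff c x₀) := by
  unfold spaceCutoff
  exact contDiff_const.sub (contDiff_const.mul ((contDiff_fst.sub contDiff_const).norm_sq ℝ))

theorem contDiff_cutoff : ContDiff ℝ ∞ (cutoff c x₀ t₀) :=
  (contDiff_timeCutoff c t₀).mul ((contDiff_spaceCutoff c x₀).pow 2)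

theorem dirDeriv_timeCutoff (d p : SpaceTime n) : dirDeriv d (timeCutoff c t₀) p = c * d.2 := by
  have h : HasFDerivAt (timeCutoff c t₀ : SpaceTime n → ℝ) (c • ContinuousLinearMap.snd ℝ (EuclideanSpace ℝ (Fin n)) ℝ) p :=
    ((hasFDerivAt_snd.sub_const t₀).const_mul c).const_add 1
  rw [dirDeriv, h.fderiv]
  simp

theorem dirDeriv_spaceCutoff (d p : SpaceTime n) :
    dirDeriv d (spaceCutoff c x₀) p = -(c * (2 * inner ℝ (p.1 - x₀) d.1)) := by
  have h : HasFDerivAt (spaceCutoff c x₀) _ p :=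
    (((hasFDerivAt_fst.sub_const x₀).norm_sq).const_mul c).const_sub 1
  rw [dirDeriv, h.fderiv]
  simp [inner_sub_left]

theorem dirDeriv_coord (d p : SpaceTime n) (i : Fin n) :
    dirDeriv d (fun q : SpaceTime n => q.1 i - x₀ i) p = d.1 i := by
  have h : HasFDerivAt (fun q : SpaceTime n => q.1 i - x₀ i)
      ((EuclideanSpace.proj i : EuclideanSpace ℝ (Fin n) →L[ℝ] ℝ).comp (ContinuousLinearMap.fst ℝ (EuclideanSpace ℝ (Fin n)) ℝ)) p :=
    ((EuclideanSpace.proj i : EuclideanSpace ℝ (Fin n) →L[ℝ] ℝ).comp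
      (ContinuousLinearMap.fst ℝ (EuclideanSpace ℝ (Fin n)) ℝ)).hasFDerivAt.sub_const (x₀ i)
  rw [dirDeriv, h.fderiv]
  simp

theorem dirDeriv_time_cutoff (p : SpaceTime n) :
    dirDeriv timeDir (cutoff c x₀ t₀) p = c * spaceCutoff c x₀ p ^ 2 := by
  have h1 := ((contDiff_timeCutoff (n := n) c t₀).contDiffAt (x := p)).differentiableAt_of_smooth
  have h2 := ((contDiff_spaceCutoff c x₀).contDiffAt (x := p)).differentiableAt_of_smooth
  unfold cutoff
  rw [dirDeriv_fun_mul h1 (h2.fun_pow 2), dirDeriv_fun_sq h2, dirDeriv_timeCutoff,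
    dirDeriv_spaceCutoff]
  simp [timeDir]

theorem dirDeriv_space_spaceCutoff (p : SpaceTime n) (i : Fin n) :
    dirDeriv (spaceDir i) (spaceCutoff c x₀) p = -2 * c * (p.1 i - x₀ i) := by
  rw [dirDeriv_spaceCutoff]
  simp [spaceDir, EuclideanSpace.inner_single_right]
  ring

theorem dirDeriv_space_cutoff (p : SpaceTime n) (i : Fin n) :
    dirDeriv (spaceDir i) (cutoff c x₀ t₀) p =
      -4 * c * (timeCutoff c t₀ p * (spaceCutoff c x₀ p * (p.1 i - x₀ i))) := by
  have h1 := ((contDiff_timeCutoff (n := n) c t₀).contDiffAt (x := p)).differentiableAt_of_smooth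
  have h2 := ((contDiff_spaceCutoff c x₀).contDiffAt (x := p)).differentiableAt_of_smooth
  unfold cutoff
  rw [dirDeriv_fun_mul h1 (h2.fun_pow 2), dirDeriv_fun_sq h2, dirDeriv_timeCutoff,
    dirDeriv_space_spaceCutoff]
  simp [spaceDir]
  ring

theorem dirDeriv_space_space_cutoff (p : SpaceTime n) (i : Fin n) :
    dirDeriv (spaceDir i) (dirDeriv (spaceDir i) (cutoff c x₀ t₀)) p =
      -4 * c * timeCutoff c t₀ p * (spaceCutoff c x₀ p - 2 * c * (p.1 i - x₀ i) ^ 2) := by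
  have h1 := ((contDiff_timeCutoff (n := n) c t₀).contDiffAt (x := p)).differentiableAt_of_smooth
  have h2 := ((contDiff_spaceCutoff c x₀).contDiffAt (x := p)).differentiableAt_of_smooth
  have h3 : DifferentiableAt ℝ (fun q : SpaceTime n => q.1 i - x₀ i) p := by fun_prop
  have : dirDeriv (spaceDir i) (cutoff c x₀ t₀) = fun q =>
      -4 * c * (timeCutoff c t₀ q * (spaceCutoff c x₀ q * (q.1 i - x₀ i))) :=
    funext fun q => dirDeriv_space_cutoff c t₀ x₀ q i
  rw [this, dirDeriv_const_mul (h1.fun_mul (h2.fun_mul h3)), dirDeriv_fun_mul h1 (h2.fun_mul h3),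
    dirDeriv_fun_mul h2 h3, dirDeriv_timeCutoff, dirDeriv_space_spaceCutoff, dirDeriv_coord]
  simp [spaceDir]
  ring

end Cutoff

section GradientEstimate

variable {n : ℕ}

theorem bound_of_quadratic {κ b Y Z a ε : ℝ} (hκ : 0 < κ) (hb0 : 0 ≤ b) (hb : b ≤ 2)
    (hε : 0 ≤ ε) (hY : 0 ≤ Y) (h : κ * Y ≤ a * ε + b * Z) (hZ : Z ^ 2 ≤ 16 * ε * Y) :
    Y ≤ 2 / κ * (a + 32 / κ) * ε := by
  have h1 : (2 * Z) ^ 2 ≤ (κ * Y / 2 + 32 * ε / κ) ^ 2 := by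
    have e : (κ * Y / 2 + 32 * ε / κ) ^ 2 = (κ * Y / 2 - 32 * ε / κ) ^ 2 + 64 * ε * Y := by
      field_simp; ring
    nlinarith [sq_nonneg (κ * Y / 2 - 32 * ε / κ)]
  have h2 : |2 * Z| ≤ κ * Y / 2 + 32 * ε / κ := abs_le_of_sq_le_sq h1 (by positivity)
  have h3 : b * Z ≤ |2 * Z| := by
    rw [abs_mul, abs_two]
    exact (mul_le_mul_of_nonneg_left (le_abs_self Z) hb0).trans
      (mul_le_mul_of_nonneg_right hb (abs_nonneg Z))
  have h4 : κ * Y / 2 ≤ (a + 32 / κ) * ε := by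
    have e : (a + 32 / κ) * ε = a * ε + 32 * ε / κ := by ring
    linarith
  have e : 2 / κ * (a + 32 / κ) * ε = (2 / κ) * ((a + 32 / κ) * ε) := by ring
  rw [e]
  calc Y = (2 / κ) * (κ * Y / 2) := by field_simp
    _ ≤ _ := mul_le_mul_of_nonneg_left h4 (by positivity)

theorem sum_coord_sq (x x₀ : EuclideanSpace ℝ (Fin n)) :
    ∑ i, (x i - x₀ i) ^ 2 = ‖x - x₀‖ ^ 2 := by
  rw [EuclideanSpace.norm_sq_eq]
  simp

theorem sum_cutoff_terms_le {c t₀ : ℝ} {x₀ : EuclideanSpace ℝ (Fin n)} {q : SpaceTime n}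
    (hc : 0 < c) (hs : 0 < timeCutoff c t₀ q) (hs1 : timeCutoff c t₀ q ≤ 1)
    (hz : 0 < spaceCutoff c x₀ q) :
    ∑ i, (2 * dirDeriv (spaceDir i) (cutoff c x₀ t₀) q ^ 2 / cutoff c x₀ t₀ q
      - dirDeriv (spaceDir i) (dirDeriv (spaceDir i) (cutoff c x₀ t₀)) q) ≤ (24 + 4 * n) * c := by
  have hzN : spaceCutoff c x₀ q = 1 - c * ‖q.1 - x₀‖ ^ 2 := rfl
  set s := timeCutoff c t₀ q
  set z := spaceCutoff c x₀ q
  have hN : 0 ≤ c * ‖q.1 - x₀‖ ^ 2 := by positivity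
  have h1 : ∀ i, 2 * dirDeriv (spaceDir i) (cutoff c x₀ t₀) q ^ 2 / cutoff c x₀ t₀ q
      - dirDeriv (spaceDir i) (dirDeriv (spaceDir i) (cutoff c x₀ t₀)) q
      = 24 * c ^ 2 * s * (q.1 i - x₀ i) ^ 2 + 4 * c * s * z := by
    intro i
    rw [dirDeriv_space_space_cutoff, dirDeriv_space_cutoff, cutoff]
    change 2 * (-4 * c * (s * (z * _))) ^ 2 / (s * z ^ 2) - -4 * c * s * (z - _) = _
    field_simp
    ring
  simp only [h1, Finset.sum_add_distrib, ← Finset.mul_sum, sum_coord_sq, Finset.sum_const,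
    Finset.card_univ, Fintype.card_fin, nsmul_eq_mul]
  have h2 : s * (c * ‖q.1 - x₀‖ ^ 2) ≤ 1 := mul_le_one₀ hs1 hN (by linarith)
  have h3 : s * z ≤ 1 := mul_le_one₀ hs1 hz.le (by linarith)
  have h4 := mul_le_mul_of_nonneg_left h2 (by positivity : 0 ≤ 24 * c)
  have h5 := mul_le_mul_of_nonneg_left h3 (by positivity : 0 ≤ 4 * n * c)
  linarith

theorem sq_inner_cutoff_le {c t₀ : ℝ} {x₀ : EuclideanSpace ℝ (Fin n)} {q : SpaceTime n}
    (hc : 0 < c) (hs : 0 < timeCutoff c t₀ q) (hs1 : timeCutoff c t₀ q ≤ 1)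
    (hz : 0 < spaceCutoff c x₀ q) (g : Fin n → ℝ) :
    (∑ i, g i * dirDeriv (spaceDir i) (cutoff c x₀ t₀) q) ^ 2 ≤
      16 * c * (cutoff c x₀ t₀ q * ∑ i, g i ^ 2) := by
  have hzN : spaceCutoff c x₀ q = 1 - c * ‖q.1 - x₀‖ ^ 2 := rfl
  have hη : cutoff c x₀ t₀ q = timeCutoff c t₀ q * spaceCutoff c x₀ q ^ 2 := rfl
  have hG : 0 ≤ ∑ i, g i ^ 2 := Finset.sum_nonneg fun i _ => sq_nonneg _
  refine (Finset.sum_mul_sq_le_sq_mul_sq _ _ _).trans ?_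
  have h1 : ∑ i, dirDeriv (spaceDir i) (cutoff c x₀ t₀) q ^ 2
      = 16 * c * (timeCutoff c t₀ q * (c * ‖q.1 - x₀‖ ^ 2)) * cutoff c x₀ t₀ q := by
    rw [← sum_coord_sq, hη]
    simp only [dirDeriv_space_cutoff, Finset.mul_sum, Finset.sum_mul]
    exact Finset.sum_congr rfl fun i _ => by ring
  have hN : 0 ≤ c * ‖q.1 - x₀‖ ^ 2 := by positivity
  have h2 : timeCutoff c t₀ q * (c * ‖q.1 - x₀‖ ^ 2) ≤ 1 := mul_le_one₀ hs1 hN (by linarith)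
  have h3 : 0 ≤ cutoff c x₀ t₀ q := by rw [hη]; positivity
  have h4 := mul_le_mul_of_nonneg_left h2
    (by positivity : 0 ≤ 16 * c * (cutoff c x₀ t₀ q * ∑ i, g i ^ 2))
  rw [h1]
  linarith

/-- A positive solution `w` of `∂ₜw = A (Δw + β |∇w|² / w)` for times before `t₀`, the coefficient
`A` being (up to a constant factor) the power `w ^ (1 - β)`, and `F = |∇w|²`. -/
structure IsPressureFlow (t₀ β : ℝ) (w A F : SpaceTime n → ℝ) : Prop where
  smooth : ∀ p ∈ {p : SpaceTime n | p.2 < t₀}, ContDiffAt ℝ ∞ w p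
  smooth_coeff : ∀ p ∈ {p : SpaceTime n | p.2 < t₀}, ContDiffAt ℝ ∞ A p
  pos : ∀ p ∈ {p : SpaceTime n | p.2 < t₀}, 0 < w p
  pos_coeff : ∀ p ∈ {p : SpaceTime n | p.2 < t₀}, 0 < A p
  sq_grad : F = fun p => ∑ i, dirDeriv (spaceDir i) w p ^ 2
  deriv_coeff : ∀ p ∈ {p : SpaceTime n | p.2 < t₀}, ∀ i,
    dirDeriv (spaceDir i) A p = (1 - β) * A p * dirDeriv (spaceDir i) w p / w p
  eqn : ∀ p ∈ {p : SpaceTime n | p.2 < t₀}, dirDeriv timeDir w p =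
    A p * (∑ i, dirDeriv (spaceDir i) (dirDeriv (spaceDir i) w) p + β * (F p * (w p)⁻¹))

theorem isOpen_before (t₀ : ℝ) : IsOpen {p : SpaceTime n | p.2 < t₀} :=
  isOpen_lt continuous_snd continuous_const

/-- Local gradient estimate on the parabolic cylinder of radius `R`. -/
theorem IsPressureFlow.cutoff_mul_le {t₀ β : ℝ} {w A F : SpaceTime n → ℝ}
    (h : IsPressureFlow t₀ β w A F) (hn : 2 ≤ n) (hβ0 : 0 < β) (hβ1 : β ≤ 1) {κ : ℝ}
    (hκ : κ = 2 * β ^ 2 - (n - 1) * (1 - β) ^ 2 / 2) (hκ0 : 0 < κ)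
    {x₀ : EuclideanSpace ℝ (Fin n)} {R ε : ℝ} (hR : 0 < R) (hε : 0 ≤ ε)
    (hbound : ∀ p : SpaceTime n, ‖p.1 - x₀‖ ≤ R → t₀ - R ^ 2 ≤ p.2 → p.2 < t₀ →
      w p ^ 2 ≤ ε * R ^ 2 ∧ w p ^ 2 / A p ≤ ε * R ^ 2)
    {p : SpaceTime n} (hpx : ‖p.1 - x₀‖ ≤ R) (hpt : t₀ - R ^ 2 ≤ p.2) (hp : p.2 < t₀) :
    cutoff (R ^ 2)⁻¹ x₀ t₀ p * F p ≤ 2 / κ * (25 + 4 * n + 32 / κ) * ε := by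
  set c := (R ^ 2)⁻¹ with hc
  have hc0 : 0 < c := by positivity
  have hcR : c * R ^ 2 = 1 := inv_mul_cancel₀ (by positivity)
  have hΩ := isOpen_before (n := n) t₀
  have hηs : ∀ q : SpaceTime n, ContDiffAt ℝ ∞ (cutoff c x₀ t₀) q :=
    fun q => (contDiff_cutoff c t₀ x₀).contDiffAt
  have hFs : ∀ q ∈ {p : SpaceTime n | p.2 < t₀}, ContDiffAt ℝ ∞ F q := by
    intro q hq
    rw [h.sq_grad]
    exact ContDiffAt.sum fun i _ => ((h.smooth q hq).dirDeriv _).pow 2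
  have hGs : ∀ q ∈ {p : SpaceTime n | p.2 < t₀},
      ContDiffAt ℝ ∞ (fun q => cutoff c x₀ t₀ q * F q) q :=
    fun q hq => (hηs q).mul (hFs q hq)
  set K : Set (SpaceTime n) := closedBall x₀ R ×ˢ Icc (t₀ - R ^ 2) p.2 with hK
  have hKmem : ∀ q : SpaceTime n, q ∈ K ↔ ‖q.1 - x₀‖ ≤ R ∧ t₀ - R ^ 2 ≤ q.2 ∧ q.2 ≤ p.2 := by
    intro q
    rw [hK, mem_prod, mem_closedBall, dist_eq_norm, mem_Icc]
  have hKc : IsCompact K := (isCompact_closedBall x₀ R).prod isCompact_Icc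
  have hpK : p ∈ K := (hKmem p).2 ⟨hpx, hpt, le_rfl⟩
  have hcont : ContinuousOn (fun q => cutoff c x₀ t₀ q * F q) K := fun q hq =>
    (hGs q (((hKmem q).1 hq).2.2.trans_lt hp)).continuousAt.continuousWithinAt
  obtain ⟨q, hqK, hqmax⟩ := hKc.exists_isMaxOn ⟨p, hpK⟩ hcont
  refine (hqmax hpK).trans ?_
  obtain ⟨hqx, hqt, hqp⟩ := (hKmem q).1 hqK
  have hqt₀ : q.2 < t₀ := hqp.trans_lt hp
  change cutoff c x₀ t₀ q * F q ≤ _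
  rcases le_or_gt (cutoff c x₀ t₀ q * F q) 0 with hle | hpos
  · exact hle.trans (by positivity)
  have hF0 : 0 ≤ F q := by
    rw [h.sq_grad]; exact Finset.sum_nonneg fun i _ => sq_nonneg _
  have hηq : 0 < cutoff c x₀ t₀ q := by
    by_contra! hcon
    exact absurd hpos (not_lt.2 (mul_nonpos_of_nonpos_of_nonneg hcon hF0))
  have hFq : 0 < F q := pos_of_mul_pos_right hpos hηq.le
  have hs0 : 0 < timeCutoff c t₀ q := by
    by_contra! hcon
    exact absurd hηq (not_lt.2 (mul_nonpos_of_nonpos_of_nonneg hcon (sq_nonneg _)))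
  have hs1 : timeCutoff c t₀ q ≤ 1 := by
    unfold timeCutoff; nlinarith
  have hz : 0 < spaceCutoff c x₀ q := by
    refine lt_of_le_of_ne ?_ ?_
    · have : ‖q.1 - x₀‖ ^ 2 ≤ R ^ 2 := by gcongr
      unfold spaceCutoff
      nlinarith
    · intro h0
      simp [cutoff, ← h0] at hηq
  have hqx' : ‖q.1 - x₀‖ < R := by
    refine lt_of_pow_lt_pow_left₀ 2 hR.le ?_
    unfold spaceCutoff at hz
    exact lt_of_mul_lt_mul_left (by linarith : c * ‖q.1 - x₀‖ ^ 2 < c * R ^ 2) hc0.le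
  have hqt' : t₀ - R ^ 2 < q.2 := by
    unfold timeCutoff at hs0
    have : c * (t₀ - q.2) < c * R ^ 2 := by linarith
    linarith [lt_of_mul_lt_mul_left this hc0.le]
  have hxmax : ∀ i, ∀ᶠ r in 𝓝 (0 : ℝ), (fun q => cutoff c x₀ t₀ q * F q) (q + r • spaceDir i)
      ≤ (fun q => cutoff c x₀ t₀ q * F q) q := by
    intro i
    have ho : IsOpen {p : SpaceTime n | ‖p.1 - x₀‖ < R} :=
      isOpen_lt (by fun_prop) continuous_const
    filter_upwards [(tendsto_line q (spaceDir i)).eventually (ho.mem_nhds hqx')] with r hr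
    refine hqmax ((hKmem _).2 ⟨le_of_lt hr, by simpa [spaceDir] using hqt, by simpa [spaceDir]⟩)
  have htmax : ∀ᶠ r in 𝓝[<] (0 : ℝ), (fun q => cutoff c x₀ t₀ q * F q) (q + r • timeDir)
      ≤ (fun q => cutoff c x₀ t₀ q * F q) q := by
    have ho : IsOpen {p : SpaceTime n | t₀ - R ^ 2 < p.2} :=
      isOpen_lt continuous_const continuous_snd
    filter_upwards [((tendsto_line q timeDir).eventually (ho.mem_nhds hqt')).filter_mono
      nhdsWithin_le_nhds, self_mem_nhdsWithin] with r hr hr0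
    have hr0 : r < 0 := hr0
    refine hqmax ((hKmem _).2 ⟨by simpa [timeDir], le_of_lt hr, ?_⟩)
    simp [timeDir]
    linarith
  have dη := (hηs q).differentiableAt_of_smooth
  have dF := (hFs q hqt₀).differentiableAt_of_smooth
  have dG := (hGs q hqt₀).differentiableAt_of_smooth
  have h1 : ∀ i, dirDeriv (spaceDir i) (cutoff c x₀ t₀) q * F q
      + cutoff c x₀ t₀ q * dirDeriv (spaceDir i) F q = 0 := by
    intro i
    rw [← dirDeriv_fun_mul dη dF]
    exact dirDeriv_eq_zero_of_max dG (hxmax i)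
  have h2 : ∀ i, dirDeriv (spaceDir i) (dirDeriv (spaceDir i) (cutoff c x₀ t₀)) q * F q
      + 2 * (dirDeriv (spaceDir i) (cutoff c x₀ t₀) q * dirDeriv (spaceDir i) F q)
      + cutoff c x₀ t₀ q * dirDeriv (spaceDir i) (dirDeriv (spaceDir i) F) q ≤ 0 := by
    intro i
    rw [← dirDeriv_dirDeriv_mul hΩ hqt₀ (fun q _ => hηs q) hFs]
    exact dirDeriv_dirDeriv_nonpos_of_max hΩ hqt₀ hGs (hxmax i)
  have ht : 0 ≤ dirDeriv timeDir (cutoff c x₀ t₀) q * F q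
      + cutoff c x₀ t₀ q * dirDeriv timeDir F q := by
    rw [← dirDeriv_fun_mul dη dF]
    exact dirDeriv_nonneg_of_left_max dG htmax
  have hB := bernstein_inequality (by simpa using hn) hΩ h.smooth h.smooth_coeff h.pos
    h.pos_coeff h.sq_grad h.deriv_coeff h.eqn hqt₀ hFq.ne'
  rw [Fintype.card_fin, ← hκ] at hB
  have hmain := cutoff_mul_le_of_max_algebra (h.pos_coeff q hqt₀) (h.pos q hqt₀) hηq hFq
    h1 h2 ht hB
  obtain ⟨hb1, hb2⟩ := hbound q hqx hqt hqt₀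
  have hA0 := h.pos_coeff q hqt₀
  have hcε : c * (ε * R ^ 2) = ε := by rw [mul_left_comm, hcR, mul_one]
  refine bound_of_quadratic (b := 1 + β) hκ0 (by linarith) (by linarith) hε hpos.le
    (hmain.trans (add_le_add_left ?_ _)) ?_
  · rw [dirDeriv_time_cutoff]
    have hz1 : spaceCutoff c x₀ q ≤ 1 := by
      unfold spaceCutoff
      have : 0 ≤ c * ‖q.1 - x₀‖ ^ 2 := by positivity
      linarith
    have t1 : c * spaceCutoff c x₀ q ^ 2 * (w q ^ 2 / A q) ≤ ε := by
      calc _ ≤ c * 1 * (ε * R ^ 2) := by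
            gcongr
            exact pow_le_one₀ hz.le hz1
        _ = ε := by rw [mul_one, hcε]
    have t2 := mul_le_mul_of_nonneg_left (sum_cutoff_terms_le (x₀ := x₀) hc0 hs0 hs1 hz)
      (sq_nonneg (w q))
    have t3 : w q ^ 2 * ((24 + 4 * n) * c) ≤ (24 + 4 * n) * ε := by
      calc _ ≤ (ε * R ^ 2) * ((24 + 4 * n) * c) := by gcongr
        _ = (24 + 4 * n) * (c * (ε * R ^ 2)) := by ring
        _ = _ := by rw [hcε]
    linarith
  · have hc1 := sq_inner_cutoff_le (x₀ := x₀) hc0 hs0 hs1 hz fun i => dirDeriv (spaceDir i) w q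
    have hFq' : ∑ i, dirDeriv (spaceDir i) w q ^ 2 = F q := by rw [h.sq_grad]
    rw [hFq'] at hc1
    calc _ = w q ^ 2 * (∑ i, dirDeriv (spaceDir i) w q
            * dirDeriv (spaceDir i) (cutoff c x₀ t₀) q) ^ 2 := by ring
      _ ≤ (ε * R ^ 2) * (16 * c * (cutoff c x₀ t₀ q * F q)) := by gcongr
      _ = 16 * (c * (ε * R ^ 2)) * (cutoff c x₀ t₀ q * F q) := by ring
      _ = _ := by rw [hcε]

theorem tendsto_cutoff (x₀ : EuclideanSpace ℝ (Fin n)) (t₀ : ℝ) (p : SpaceTime n) :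
    Tendsto (fun R : ℝ => cutoff (R ^ 2)⁻¹ x₀ t₀ p) atTop (𝓝 1) := by
  have h : Tendsto (fun R : ℝ => (R ^ 2)⁻¹) atTop (𝓝 0) :=
    tendsto_inv_atTop_zero.comp (tendsto_pow_atTop two_ne_zero)
  have hc : Continuous fun c : ℝ => cutoff c x₀ t₀ p := by
    unfold cutoff timeCutoff spaceCutoff
    fun_prop
  have h1 : cutoff 0 x₀ t₀ p = 1 := by simp [cutoff, timeCutoff, spaceCutoff]
  have := (hc.tendsto 0).comp h
  rwa [h1] at this

theorem IsPressureFlow.grad_eq_zero {t₀ β : ℝ} {w A F : SpaceTime n → ℝ}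
    (h : IsPressureFlow t₀ β w A F) (hn : 2 ≤ n) (hβ0 : 0 < β) (hβ1 : β ≤ 1)
    (hκ0 : 0 < 2 * β ^ 2 - (n - 1) * (1 - β) ^ 2 / 2)
    {x₀ : EuclideanSpace ℝ (Fin n)}
    (hgrowth : ∀ ε > 0, ∀ᶠ R : ℝ in atTop, ∀ p : SpaceTime n, ‖p.1 - x₀‖ ≤ R →
      t₀ - R ^ 2 ≤ p.2 → p.2 < t₀ → w p ^ 2 ≤ ε * R ^ 2 ∧ w p ^ 2 / A p ≤ ε * R ^ 2)
    {p : SpaceTime n} (hp : p.2 < t₀) : F p = 0 := by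
  refine le_antisymm ?_ (by rw [h.sq_grad]; exact Finset.sum_nonneg fun i _ => sq_nonneg _)
  set κ := 2 * β ^ 2 - (n - 1) * (1 - β) ^ 2 / 2 with hκ
  set C := 2 / κ * (25 + 4 * n + 32 / κ) with hC
  have hC0 : 0 < C := by positivity
  refine le_of_forall_pos_le_add fun δ hδ => ?_
  rw [zero_add]
  have hlim : Tendsto (fun R : ℝ => cutoff (R ^ 2)⁻¹ x₀ t₀ p * F p) atTop (𝓝 (F p)) := by
    simpa using (tendsto_cutoff x₀ t₀ p).mul_const (F p)
  refine le_of_tendsto hlim ?_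
  have hsq : Tendsto (fun R : ℝ => R ^ 2) atTop atTop := tendsto_pow_atTop two_ne_zero
  filter_upwards [hgrowth (δ / C) (by positivity), eventually_gt_atTop 0,
    eventually_ge_atTop ‖p.1 - x₀‖, hsq.eventually_ge_atTop (t₀ - p.2)] with R hb hR hx ht
  have := h.cutoff_mul_le hn hβ0 hβ1 hκ hκ0 hR (by positivity : 0 ≤ δ / C) hb hx
    (by linarith) hp
  rwa [← hC, mul_div_cancel₀ _ hC0.ne'] at this

theorem dirDeriv_eq_fderiv (d p : SpaceTime n) (f : SpaceTime n → ℝ) :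
    fderiv ℝ f p d = ∑ i, d.1 i * dirDeriv (spaceDir i) f p + d.2 * dirDeriv timeDir f p := by
  have hd : d = ∑ i, d.1 i • spaceDir i + d.2 • timeDir := by
    refine Prod.ext ?_ ?_
    · ext j
      simp [spaceDir, timeDir, Prod.fst_sum, Pi.single_apply]
    · simp [spaceDir, timeDir, Prod.snd_sum]
  conv_lhs => rw [hd]
  simp [dirDeriv, map_sum]

/-- Liouville theorem in terms of `w`. -/
theorem IsPressureFlow.eq_const {t₀ β : ℝ} {w A F : SpaceTime n → ℝ}
    (h : IsPressureFlow t₀ β w A F) (hn : 2 ≤ n) (hβ0 : 0 < β) (hβ1 : β ≤ 1)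
    (hκ0 : 0 < 2 * β ^ 2 - (n - 1) * (1 - β) ^ 2 / 2)
    {x₀ : EuclideanSpace ℝ (Fin n)}
    (hgrowth : ∀ ε > 0, ∀ᶠ R : ℝ in atTop, ∀ p : SpaceTime n, ‖p.1 - x₀‖ ≤ R →
      t₀ - R ^ 2 ≤ p.2 → p.2 < t₀ → w p ^ 2 ≤ ε * R ^ 2 ∧ w p ^ 2 / A p ≤ ε * R ^ 2)
    {p q : SpaceTime n} (hp : p.2 < t₀) (hq : q.2 < t₀) : w p = w q := by
  have hΩ := isOpen_before (n := n) t₀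
  have hF : ∀ r : SpaceTime n, r.2 < t₀ → F r = 0 :=
    fun r hr => h.grad_eq_zero hn hβ0 hβ1 hκ0 hgrowth hr
  have hi : ∀ r ∈ {r : SpaceTime n | r.2 < t₀}, ∀ i, dirDeriv (spaceDir i) w r = 0 := by
    intro r hr i
    have h0 := hF r hr
    rw [h.sq_grad, Finset.sum_eq_zero_iff_of_nonneg fun i _ => sq_nonneg _] at h0
    exact pow_eq_zero_iff two_ne_zero |>.1 (h0 i (Finset.mem_univ i))
  have ht : ∀ r ∈ {r : SpaceTime n | r.2 < t₀}, dirDeriv timeDir w r = 0 := by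
    intro r hr
    have h2 : ∀ i, dirDeriv (spaceDir i) (dirDeriv (spaceDir i) w) r = 0 := by
      intro i
      rw [dirDeriv_congr hΩ hr (g := fun _ => 0) fun s hs => hi s hs i]
      simp [dirDeriv]
    rw [h.eqn r hr, hF r hr]
    simp [h2]
  have hconv : Convex ℝ {r : SpaceTime n | r.2 < t₀} := by
    exact convex_halfSpace_lt (LinearMap.snd ℝ (EuclideanSpace ℝ (Fin n)) ℝ).isLinear t₀
  refine hΩ.is_const_of_fderiv_eq_zero (𝕜 := ℝ) hconv.isPreconnected
    (fun r hr => (h.smooth r hr).differentiableAt_of_smooth.differentiableWithinAt) ?_ hp hq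
  intro r hr
  ext d
  · simp [dirDeriv_eq_fderiv, hi r hr, ht r hr]
  · simp [dirDeriv_eq_fderiv, hi r hr, ht r hr]

end GradientEstimate

section PorousMedium

variable {n : ℕ}

theorem fderiv_slice {f : SpaceTime n → ℝ} {x : EuclideanSpace ℝ (Fin n)} {t : ℝ}
    (hf : DifferentiableAt ℝ f (x, t)) (i : Fin n) :
    fderiv ℝ (fun y => f (y, t)) x (EuclideanSpace.single i 1) =
      dirDeriv (spaceDir i) f (x, t) := by
  have h := hf.hasFDerivAt.comp x (hasFDerivAt_prodMk_left (𝕜 := ℝ) x t)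
  change fderiv ℝ (f ∘ fun y => (y, t)) x _ = _
  rw [h.fderiv]
  simp [dirDeriv, spaceDir]

theorem deriv_slice {f : SpaceTime n → ℝ} {p : SpaceTime n} (hf : DifferentiableAt ℝ f p) :
    deriv (fun s => f (p.1, s)) p.2 = dirDeriv timeDir f p := by
  have h : HasFDerivAt (fun s => f (p.1, s)) _ p.2 :=
    HasFDerivAt.comp (g := f) p.2 hf.hasFDerivAt (hasFDerivAt_prodMk_right (𝕜 := ℝ) p.1 p.2)
  rw [← fderiv_apply_one_eq_deriv, h.fderiv]
  simp [dirDeriv, timeDir]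

theorem lap_slice {f : SpaceTime n → ℝ} {t₀ : ℝ}
    (hf : ∀ q ∈ {q : SpaceTime n | q.2 < t₀}, ContDiffAt ℝ ∞ f q) {p : SpaceTime n}
    (hp : p.2 < t₀) :
    lap (fun y => f (y, p.2)) p.1 = ∑ i, dirDeriv (spaceDir i) (dirDeriv (spaceDir i) f) p := by
  refine Finset.sum_congr rfl fun i _ => ?_
  have h1 : (fun y => fderiv ℝ (fun z => f (z, p.2)) y (EuclideanSpace.single i 1)) =
      fun y => dirDeriv (spaceDir i) f (y, p.2) :=
    funext fun y => fderiv_slice (hf (y, p.2) hp).differentiableAt_of_smooth i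
  rw [h1]
  exact fderiv_slice ((hf p hp).dirDeriv _).differentiableAt_of_smooth i

theorem dirDeriv_dirDeriv_rpow {V : Type*} [NormedAddCommGroup V] [NormedSpace ℝ V]
    {s : Set V} (hs : IsOpen s) {f : V → ℝ} (hf : ∀ q ∈ s, ContDiffAt ℝ ∞ f q)
    (h0 : ∀ q ∈ s, 0 < f q) (r : ℝ) (e : V) {p : V} (hp : p ∈ s) :
    dirDeriv e (dirDeriv e (fun q => f q ^ r)) p =
      r * (f p ^ r * ((r - 1) * dirDeriv e f p ^ 2 / f p ^ 2
        + dirDeriv e (dirDeriv e f) p / f p)) := by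
  have df := fun q hq => (hf q hq).differentiableAt_of_smooth
  have ddf := ((hf p hp).dirDeriv e).differentiableAt_of_smooth
  have hpos := h0 p hp
  have dr : DifferentiableAt ℝ (fun q => f q ^ (r - 1)) p :=
    (df p hp).rpow_const (Or.inl hpos.ne')
  rw [dirDeriv_congr hs hp (fun q hq => dirDeriv_fun_rpow (df q hq) (h0 q hq) r e),
    dirDeriv_fun_mul (dr.const_mul r) ddf, dirDeriv_const_mul dr,
    dirDeriv_fun_rpow (df p hp) hpos, Real.rpow_sub_one hpos.ne', Real.rpow_sub_one hpos.ne']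
  field_simp

/-- If `u` solves the porous medium equation, then `w = u ^ (m - 1 / 2)` is a pressure flow. -/
theorem isPressureFlow_of_pme {m t₀ : ℝ} (hm : 1 < m) {u : SpaceTime n → ℝ}
    (hu : ∀ p ∈ {p : SpaceTime n | p.2 < t₀}, ContDiffAt ℝ ∞ u p)
    (hpos : ∀ p ∈ {p : SpaceTime n | p.2 < t₀}, 0 < u p)
    (hpde : ∀ p ∈ {p : SpaceTime n | p.2 < t₀},
      deriv (fun s => u (p.1, s)) p.2 = lap (fun y => u (y, p.2) ^ m) p.1) :
    IsPressureFlow t₀ (1 / (2 * m - 1)) (fun p => u p ^ (m - 1 / 2))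
      (fun p => m * u p ^ (m - 1))
      (fun p => ∑ i, dirDeriv (spaceDir i) (fun p => u p ^ (m - 1 / 2)) p ^ 2) := by
  have hΩ := isOpen_before (n := n) t₀
  have hrpow : ∀ r : ℝ, ∀ p ∈ {p : SpaceTime n | p.2 < t₀},
      ContDiffAt ℝ ∞ (fun p => u p ^ r) p :=
    fun r p hp => (hu p hp).rpow_const_of_ne (hpos p hp).ne'
  have h2m : 2 * m - 1 ≠ 0 := by linarith
  refine ⟨hrpow _, fun p hp => contDiffAt_const.mul (hrpow _ p hp),
    fun p hp => Real.rpow_pos_of_pos (hpos p hp) _,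
    fun p hp => mul_pos (by linarith) (Real.rpow_pos_of_pos (hpos p hp) _), rfl, ?_, ?_⟩
  · intro p hp i
    have h0 := hpos p hp
    have hd := (hu p hp).differentiableAt_of_smooth
    have ha : 0 < u p ^ (m - 1 / 2) := Real.rpow_pos_of_pos h0 _
    rw [dirDeriv_const_mul (hrpow _ p hp).differentiableAt_of_smooth, dirDeriv_fun_rpow hd h0,
      dirDeriv_fun_rpow hd h0, Real.rpow_sub_one h0.ne' (m - 1),
      Real.rpow_sub_one h0.ne' (m - 1 / 2)]
    have h2m' : m * 2 - 1 ≠ 0 := by linarith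
    have hβ : 1 - 1 / (2 * m - 1) = 2 * (m - 1) / (2 * m - 1) := by field_simp; ring
    have hγ : m - 1 / 2 = (2 * m - 1) / 2 := by ring
    generalize u p ^ (m - 1 / 2) = a at ha
    rw [hβ, hγ]
    field_simp
  · intro p hp
    have h0 := hpos p hp
    have hd := (hu p hp).differentiableAt_of_smooth
    have ha : 0 < u p ^ (m - 1 / 2) := Real.rpow_pos_of_pos h0 _
    have hut : dirDeriv timeDir u p = m * (u p ^ m *
        ((m - 1) / u p ^ 2 * ∑ i, dirDeriv (spaceDir i) u p ^ 2
          + 1 / u p * ∑ i, dirDeriv (spaceDir i) (dirDeriv (spaceDir i) u) p)) := by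
      rw [← deriv_slice hd, hpde p hp, lap_slice (hrpow m) hp]
      simp only [dirDeriv_dirDeriv_rpow hΩ hu hpos m _ hp, Finset.mul_sum,
        ← Finset.sum_add_distrib]
      exact Finset.sum_congr rfl fun i _ => by ring
    have hF : ∑ i, dirDeriv (spaceDir i) (fun p => u p ^ (m - 1 / 2)) p ^ 2
        = ((m - 1 / 2) * (u p ^ (m - 1 / 2) / u p)) ^ 2
          * ∑ i, dirDeriv (spaceDir i) u p ^ 2 := by
      rw [Finset.mul_sum]
      refine Finset.sum_congr rfl fun i _ => ?_
      rw [dirDeriv_fun_rpow hd h0, Real.rpow_sub_one h0.ne']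
      ring
    have hL : ∑ i, dirDeriv (spaceDir i) (dirDeriv (spaceDir i) (fun p => u p ^ (m - 1 / 2))) p
        = (m - 1 / 2) * (u p ^ (m - 1 / 2) *
        ((m - 1 / 2 - 1) / u p ^ 2 * ∑ i, dirDeriv (spaceDir i) u p ^ 2
          + 1 / u p * ∑ i, dirDeriv (spaceDir i) (dirDeriv (spaceDir i) u) p)) := by
      simp only [dirDeriv_dirDeriv_rpow hΩ hu hpos (m - 1 / 2) _ hp, Finset.mul_sum,
        ← Finset.sum_add_distrib]
      exact Finset.sum_congr rfl fun i _ => by ring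
    rw [dirDeriv_fun_rpow hd h0, hut, hL, hF, Real.rpow_sub_one h0.ne' (m - 1 / 2),
      Real.rpow_sub_one h0.ne' m]
    set S := ∑ i, dirDeriv (spaceDir i) u p ^ 2
    set D := ∑ i, dirDeriv (spaceDir i) (dirDeriv (spaceDir i) u) p
    field_simp
    ring

theorem pressure_constant_pos {m : ℝ} (hn : 2 ≤ n) (hm1 : 1 < m)
    (hm2 : m < 1 + Real.sqrt (1 / ((n : ℝ) - 1))) :
    0 < 2 * (1 / (2 * m - 1)) ^ 2 - ((n : ℝ) - 1) * (1 - 1 / (2 * m - 1)) ^ 2 / 2 := by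
  have hn' : (2 : ℝ) ≤ n := by exact_mod_cast hn
  have h1 : (m - 1) ^ 2 < 1 / ((n : ℝ) - 1) :=
    (Real.lt_sqrt (by linarith)).1 (by linarith)
  have h2 : ((n : ℝ) - 1) * (m - 1) ^ 2 < 1 := by
    rw [lt_div_iff₀ (by linarith)] at h1
    linarith
  have h3 : 0 < 2 * m - 1 := by linarith
  have e : 2 * (1 / (2 * m - 1)) ^ 2 - ((n : ℝ) - 1) * (1 - 1 / (2 * m - 1)) ^ 2 / 2
      = 2 / (2 * m - 1) ^ 2 * (1 - ((n : ℝ) - 1) * (m - 1) ^ 2) := by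
    field_simp
    ring
  rw [e]
  exact mul_pos (by positivity) (by linarith)

theorem rpow_bounds_of_rpow_le {m ε y R : ℝ} (hm : 1 < m) (hε : 0 < ε) (hy : 0 < y) (hR : 1 ≤ R)
    (h : y ^ (m - 1) ≤ min 1 ε ^ (m - 1) * R ^ (2 * (m - 1) / (2 * m - 1))) :
    (y ^ (m - 1 / 2)) ^ 2 ≤ ε * R ^ 2 ∧ (y ^ (m - 1 / 2)) ^ 2 / (m * y ^ (m - 1)) ≤ ε * R ^ 2 := by
  have hR0 : 0 < R := by linarith
  have h2m : 0 < 2 * m - 1 := by linarith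
  set η := min 1 ε with hη
  have hη0 : 0 < η := lt_min one_pos hε
  have hηr : ∀ r : ℝ, 1 ≤ r → η ^ r ≤ ε := fun r hr =>
    calc η ^ r ≤ η ^ (1 : ℝ) := Real.rpow_le_rpow_of_exponent_ge hη0 (min_le_left _ _) hr
      _ ≤ ε := by rw [Real.rpow_one]; exact min_le_right _ _
  have hy1 : y ≤ η * R ^ (2 / (2 * m - 1)) := by
    have e : η ^ (m - 1) * R ^ (2 * (m - 1) / (2 * m - 1))
        = (η * R ^ (2 / (2 * m - 1))) ^ (m - 1) := by
      rw [Real.mul_rpow hη0.le (Real.rpow_nonneg hR0.le _), ← Real.rpow_mul hR0.le]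
      congr 2
      ring
    rw [e] at h
    exact (Real.rpow_le_rpow_iff hy.le (by positivity) (by linarith)).1 h
  have hyr : ∀ r : ℝ, 1 ≤ r → r ≤ 2 * m - 1 → y ^ r ≤ ε * R ^ 2 := by
    intro r hr1 hr2
    calc y ^ r ≤ (η * R ^ (2 / (2 * m - 1))) ^ r :=
          Real.rpow_le_rpow hy.le hy1 (by linarith)
      _ = η ^ r * R ^ (2 / (2 * m - 1) * r) := by
          rw [Real.mul_rpow hη0.le (Real.rpow_nonneg hR0.le _), ← Real.rpow_mul hR0.le]
      _ ≤ ε * R ^ (2 : ℝ) := by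
          refine mul_le_mul (hηr r hr1) (Real.rpow_le_rpow_of_exponent_le hR ?_)
            (by positivity) hε.le
          rw [div_mul_eq_mul_div, div_le_iff₀ h2m]
          linarith
      _ = ε * R ^ 2 := by rw [Real.rpow_two]
  have e1 : (y ^ (m - 1 / 2)) ^ 2 = y ^ (2 * m - 1) := by
    rw [← Real.rpow_two, ← Real.rpow_mul hy.le]
    congr 1
    ring
  rw [e1]
  refine ⟨hyr _ (by linarith) le_rfl, ?_⟩
  have e2 : y ^ (2 * m - 1) / (m * y ^ (m - 1)) = y ^ m / m := by
    have : y ^ (2 * m - 1) = y ^ m * y ^ (m - 1) := by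
      rw [← Real.rpow_add hy]
      congr 1
      ring
    rw [this]
    have := Real.rpow_pos_of_pos hy (m - 1)
    field_simp
  rw [e2]
  exact (div_le_self (Real.rpow_nonneg hy.le _) hm.le).trans (hyr m hm.le (by linarith))

theorem eventually_pressure_bounds {m t₀ : ℝ} (hm : 1 < m) {u v : SpaceTime n → ℝ}
    (hu : ContinuousOn u {p | p.2 ≤ t₀}) (hpos : ∀ p : SpaceTime n, p.2 ≤ t₀ → 0 < u p)
    (hv : ∀ p, v p = (m / (m - 1)) * u p ^ (m - 1)) {x₀ : EuclideanSpace ℝ (Fin n)}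
    (hgrowth : (fun R : ℝ => sSup (v '' (closedBall x₀ R ×ˢ Icc (t₀ - R ^ 2) t₀)))
      =o[atTop] fun R : ℝ => R ^ (2 * (m - 1) / (2 * m - 1))) {ε : ℝ} (hε : 0 < ε) :
    ∀ᶠ R : ℝ in atTop, ∀ p : SpaceTime n, ‖p.1 - x₀‖ ≤ R → t₀ - R ^ 2 ≤ p.2 → p.2 < t₀ →
      (u p ^ (m - 1 / 2)) ^ 2 ≤ ε * R ^ 2 ∧
        (u p ^ (m - 1 / 2)) ^ 2 / (m * u p ^ (m - 1)) ≤ ε * R ^ 2 := by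
  have hη : 0 < min 1 ε ^ (m - 1) := Real.rpow_pos_of_pos (lt_min one_pos hε) _
  filter_upwards [hgrowth.def hη, eventually_ge_atTop 1] with R hR hR1 p hpx hpt hp
  refine rpow_bounds_of_rpow_le hm hε (hpos p hp.le) hR1 ?_
  set K : Set (SpaceTime n) := closedBall x₀ R ×ˢ Icc (t₀ - R ^ 2) t₀
  have hKs : K ⊆ {p | p.2 ≤ t₀} := fun q hq => hq.2.2
  have hKc : IsCompact K := (isCompact_closedBall x₀ R).prod isCompact_Icc
  have hvc : ContinuousOn v K := by
    rw [funext hv]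
    exact continuousOn_const.mul
      ((hu.mono hKs).rpow_const fun q hq => Or.inl (hpos q (hKs hq)).ne')
  have hpK : p ∈ K := ⟨by rwa [mem_closedBall, dist_eq_norm], hpt, hp.le⟩
  have hle : v p ≤ sSup (v '' K) := le_csSup (hKc.bddAbove_image hvc) (mem_image_of_mem v hpK)
  have h1 : u p ^ (m - 1) ≤ v p := by
    rw [hv]
    refine le_mul_of_one_le_left (Real.rpow_nonneg (hpos p hp.le).le _) ?_
    rw [one_le_div (by linarith)]
    linarith
  calc u p ^ (m - 1) ≤ sSup (v '' K) := h1.trans hle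
    _ ≤ ‖sSup (v '' K)‖ := Real.le_norm_self _
    _ ≤ _ := hR
    _ = _ := by rw [Real.norm_of_nonneg (Real.rpow_nonneg (by linarith) _)]

end PorousMedium

/-- Theorem 4.1 (Euclidean case): Liouville theorem for the porous medium equation.
If `u` is a smooth positive ancient solution of `u_t = Δ(uᵐ)` on `ℝⁿ × (−∞, t₀]` with
`1 < m < 1 + √(1/(n−1))`, whose pressure `v = (m/(m−1)) u^{m−1}` satisfies
`sup_{B(x₀,R) × [t₀−R², t₀]} v = o(R^{2(m−1)/(2m−1)})` as `R → ∞`, then `u` is constant. -/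
theorem liouville_pme (n : ℕ) (hn : 2 ≤ n) (m : ℝ) (hm1 : 1 < m)
    (hm2 : m < 1 + Real.sqrt (1 / ((n : ℝ) - 1))) (t₀ : ℝ)
    (u v : EuclideanSpace ℝ (Fin n) × ℝ → ℝ)
    (hu : ContDiffOn ℝ (⊤ : ℕ∞) u {p | p.2 ≤ t₀})
    (hpos : ∀ p : EuclideanSpace ℝ (Fin n) × ℝ, p.2 ≤ t₀ → 0 < u p)
    (hpde : ∀ p : EuclideanSpace ℝ (Fin n) × ℝ, p.2 ≤ t₀ →
      deriv (fun s => u (p.1, s)) p.2 = lap (fun y => u (y, p.2) ^ m) p.1)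
    (hv : ∀ p, v p = (m / (m - 1)) * u p ^ (m - 1))
    (x₀ : EuclideanSpace ℝ (Fin n))
    (hgrowth : (fun R : ℝ =>
        sSup (v '' (closedBall x₀ R ×ˢ Icc (t₀ - R ^ 2) t₀)))
      =o[atTop] fun R : ℝ => R ^ (2 * (m - 1) / (2 * m - 1))) :
    ∀ p q : EuclideanSpace ℝ (Fin n) × ℝ, p.2 ≤ t₀ → q.2 ≤ t₀ → u p = u q := by
  have hΩ := isOpen_before (n := n) t₀
  have hus : ∀ p ∈ {p : SpaceTime n | p.2 < t₀}, ContDiffAt ℝ ∞ u p := fun p hp =>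
    hu.contDiffAt (mem_of_superset (hΩ.mem_nhds hp) fun q hq => (show q.2 < t₀ from hq).le)
  have hpos' : ∀ p ∈ {p : SpaceTime n | p.2 < t₀}, 0 < u p := fun p hp => hpos p (le_of_lt hp)
  have hflow := isPressureFlow_of_pme hm1 hus hpos' fun p hp => hpde p (le_of_lt hp)
  have hconst : ∀ p q : SpaceTime n, p.2 < t₀ → q.2 < t₀ → u p = u q := by
    intro p q hp hq
    have h := hflow.eq_const hn (by apply one_div_pos.2; linarith)
      ((div_le_one (by linarith)).2 (by linarith)) (pressure_constant_pos hn hm1 hm2)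
      (fun ε hε => eventually_pressure_bounds hm1 hu.continuousOn hpos hv hgrowth hε) hp hq
    exact (Real.rpow_left_inj (hpos' p hp).le (hpos' q hq).le (by linarith)).1 h
  let p₀ : SpaceTime n := (x₀, t₀ - 1)
  have hcl : {p : SpaceTime n | p.2 ≤ t₀} ⊆ closure {p | p.2 < t₀} := by
    have e : {p : SpaceTime n | p.2 < t₀} = univ ×ˢ Iio t₀ := by ext p; simp
    rw [e, closure_prod_eq, closure_Iio, closure_univ]
    exact fun p hp => ⟨mem_univ _, hp⟩
  have heq : EqOn u (fun _ => u p₀) {p : SpaceTime n | p.2 ≤ t₀} :=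
    EqOn.of_subset_closure (s := {p : SpaceTime n | p.2 < t₀})
      (fun p hp => hconst p p₀ hp (by simp [p₀])) hu.continuousOn continuousOn_const
      (fun p hp => (show p.2 < t₀ from hp).le) hcl
  intro p q hp hq
  rw [heq hp, heq hq]
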